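/- arXiv:1805.06929 — 5 statements merged into one kernel-verified Lean document; each statement's English description precedes it below -/
import Mathlib

section
/- Let κ ∈ (0,1) and let z be a real number with 1 < z < 1 + 1/κ. Then [1 − κ²(z−1)²]·(z−1)·∫₀^∞ t^{z−2} exp_κ(−t) dt = [(1−κ(z−1))/(2κ)^{z−1}] · [Γ(1/(2κ) − (z−1)/2) / Γ(1/(2κ) + (z−1)/2)] · Γ(z), i.e. the integral representation of the κ-deformed Gamma function Γ_κ(z) agrees with its closed form in terms of the Euler Gamma function. -/
open Real MeasureTheory Filter Set

/-- The κ-deformed exponential of Kaniadakis. -/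
noncomputable def kexp (κ x : ℝ) : ℝ := (Real.sqrt (1 + κ^2 * x^2) + κ * x) ^ (1/κ)

/-- The κ-deformed logarithm of Kaniadakis. -/
noncomputable def klog (κ x : ℝ) : ℝ := (x ^ κ - x ^ (-κ)) / (2*κ)

/-- The κ-deformed Gamma function (closed form in terms of the Euler Gamma function). -/
noncomputable def kGamma (κ z : ℝ) : ℝ :=
  ((1 - κ*(z-1)) / (2*κ) ^ (z-1)) *
    (Real.Gamma (1/(2*κ) - (z-1)/2) / Real.Gamma (1/(2*κ) + (z-1)/2)) * Real.Gamma z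

/-- The κ-Generalized Gamma (κGG) density. -/
noncomputable def kGG (α ν β κ x : ℝ) : ℝ :=
  (1 - κ^2*(α/ν - 1)^2) * (ν/β) * (kGamma κ (α/ν))⁻¹ * (x/β) ^ (α-1) *
    kexp κ (-((x/β) ^ ν)) / Real.sqrt (1 + κ^2 * (x/β) ^ (2*ν))

theorem integrableOn_rpow_mul_one_sub_rpow {p q : ℝ} (hp : 0 < p) (hq : 0 < q) :
    IntegrableOn (fun x : ℝ => x ^ (p - 1) * (1 - x) ^ (q - 1)) (Ioo 0 1) := by
  have h := Complex.betaIntegral_convergent (u := p) (v := q) (by simpa) (by simpa)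
  rw [intervalIntegrable_iff_integrableOn_Ioo_of_le zero_le_one] at h
  refine IntegrableOn.congr_fun h.re (fun x hx => ?_) measurableSet_Ioo
  norm_cast
  rw [← Complex.ofReal_cpow hx.1.le, ← Complex.ofReal_cpow (sub_nonneg.2 hx.2.le),
    RCLike.re_to_complex, Complex.re_mul_ofReal, Complex.ofReal_re]

theorem integral_rpow_mul_one_sub_rpow {p q : ℝ} (hp : 0 < p) (hq : 0 < q) :
    ∫ x in Ioo (0 : ℝ) 1, x ^ (p - 1) * (1 - x) ^ (q - 1) =
      Real.Gamma p * Real.Gamma q / Real.Gamma (p + q) := by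
  have h := Complex.betaIntegral_convergent (u := p) (v := q) (by simpa) (by simpa)
  rw [intervalIntegrable_iff_integrableOn_Ioo_of_le zero_le_one] at h
  change _ = ProbabilityTheory.beta p q
  rw [ProbabilityTheory.beta_eq_betaIntegralReal p q hp hq, Complex.betaIntegral,
    intervalIntegral.integral_of_le zero_le_one, integral_Ioc_eq_integral_Ioo,
    ← RCLike.re_to_complex, ← integral_re h]
  refine setIntegral_congr_fun measurableSet_Ioo fun x hx => ?_
  norm_cast
  rw [← Complex.ofReal_cpow hx.1.le, ← Complex.ofReal_cpow (sub_nonneg.2 hx.2.le),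
    RCLike.re_to_complex, Complex.re_mul_ofReal, Complex.ofReal_re]

/-- The decreasing bijection from `(0, 1)` onto `(0, ∞)` satisfying
`kexp κ (-kexpSubst κ x) = x ^ (1 / (2 * κ))`. -/
noncomputable def kexpSubst (κ x : ℝ) : ℝ := (1 - x) * x ^ (-(1 / 2) : ℝ) / (2 * κ)

theorem sqrt_sub_kexpSubst {κ x : ℝ} (hκ : 0 < κ) (hx : 0 < x) :
    √(1 + κ ^ 2 * kexpSubst κ x ^ 2) - κ * kexpSubst κ x = √x := by
  have hw : 0 < √x := Real.sqrt_pos.2 hx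
  have hsubst : κ * kexpSubst κ x = ((√x)⁻¹ - √x) / 2 := by
    rw [kexpSubst, Real.rpow_neg hx.le, ← Real.sqrt_eq_rpow]
    have := Real.sq_sqrt hx.le
    field_simp
    linarith
  have hsq : 1 + κ ^ 2 * kexpSubst κ x ^ 2 = (((√x)⁻¹ + √x) / 2) ^ 2 := by
    rw [← mul_pow, hsubst]
    field_simp
    ring
  rw [hsq, Real.sqrt_sq (by positivity), hsubst]
  ring

theorem kexp_neg_kexpSubst {κ x : ℝ} (hκ : 0 < κ) (hx : 0 < x) :
    kexp κ (-kexpSubst κ x) = x ^ (1 / (2 * κ)) := by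
  rw [kexp, neg_sq, mul_neg, ← sub_eq_add_neg, sqrt_sub_kexpSubst hκ hx, Real.sqrt_eq_rpow,
    ← Real.rpow_mul hx.le]
  congr 1
  field_simp

theorem injOn_kexpSubst {κ : ℝ} (hκ : 0 < κ) : InjOn (kexpSubst κ) (Ioo 0 1) := by
  intro x hx y hy hxy
  rw [← Real.sqrt_inj hx.1.le hy.1.le, ← sqrt_sub_kexpSubst hκ hx.1,
    ← sqrt_sub_kexpSubst hκ hy.1, hxy]

theorem kexpSubst_image {κ : ℝ} (hκ : 0 < κ) : kexpSubst κ '' Ioo 0 1 = Ioi 0 := by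
  ext t
  constructor
  · rintro ⟨x, hx, rfl⟩
    have hx1 : 0 < 1 - x := sub_pos.2 hx.2
    exact div_pos (mul_pos hx1 (Real.rpow_pos_of_pos hx.1 _)) (by positivity)
  · intro (ht : 0 < t)
    have hs : √(1 + κ ^ 2 * t ^ 2) ^ 2 = 1 + κ ^ 2 * t ^ 2 := Real.sq_sqrt (by positivity)
    have hs0 : 0 ≤ √(1 + κ ^ 2 * t ^ 2) := Real.sqrt_nonneg _
    set s := √(1 + κ ^ 2 * t ^ 2)
    have hκt : 0 < κ * t := mul_pos hκ ht
    have hpos : 0 < s - κ * t := by nlinarith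
    have hlt : s - κ * t < 1 := by nlinarith
    refine ⟨(s - κ * t) ^ 2, ⟨by positivity, by nlinarith⟩, ?_⟩
    rw [kexpSubst, Real.rpow_neg (sq_nonneg _), ← Real.sqrt_eq_rpow, Real.sqrt_sq hpos.le]
    field_simp
    linarith

theorem hasDerivAt_kexpSubst (κ : ℝ) {x : ℝ} (hx : 0 < x) :
    HasDerivAt (kexpSubst κ) (-((1 + x) * x ^ (-(3 / 2) : ℝ) / (4 * κ))) x := by
  have h := ((hasDerivAt_id x).const_sub 1).mul
    (Real.hasDerivAt_rpow_const (x := x) (p := -(1 / 2)) (Or.inl hx.ne'))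
  refine (h.div_const (2 * κ)).congr_deriv ?_
  have hx' : x ^ (-(1 / 2) : ℝ) = x * x ^ (-(3 / 2) : ℝ) := by
    rw [← Real.rpow_one_add' hx.le (by norm_num)]
    norm_num
  have h32 : (-(1 / 2) - 1 : ℝ) = -(3 / 2) := by norm_num
  simp only [id, hx', h32]
  field_simp
  ring

theorem integral_rpow_mul_kexp_neg {κ s : ℝ} (hκ : 0 < κ) (hs : 0 < s) (hs' : κ * s < 1) :
    ∫ t in Ioi (0 : ℝ), t ^ (s - 1) * kexp κ (-t) =
      Real.Gamma (1 / (2 * κ) - s / 2) * Real.Gamma s /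
        ((2 * κ) ^ s * (1 + κ * s) * Real.Gamma (1 / (2 * κ) + s / 2)) := by
  set p := 1 / (2 * κ) - s / 2 with hp_def
  have hp : 0 < p := by
    have : p = (1 - κ * s) / (2 * κ) := by rw [hp_def]; field_simp
    rw [this]
    exact div_pos (by linarith) (by positivity)
  have hpq : 1 / (2 * κ) + s / 2 = p + s := by rw [hp_def]; ring
  have key : ∀ x ∈ Ioo (0 : ℝ) 1,
      |-((1 + x) * x ^ (-(3 / 2) : ℝ) / (4 * κ))| •
        (kexpSubst κ x ^ (s - 1) * kexp κ (-kexpSubst κ x)) =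
      (1 / (2 * (2 * κ) ^ s)) * (x ^ (p - 1) * (1 - x) ^ (s - 1) +
        x ^ (p + 1 - 1) * (1 - x) ^ (s - 1)) := by
    intro x hx
    have hx0 := hx.1
    have hx1 : 0 < 1 - x := sub_pos.2 hx.2
    have hpow : x ^ (p - 1) =
        x ^ (-(3 / 2) : ℝ) * (x ^ (-(1 / 2) : ℝ)) ^ (s - 1) * x ^ (1 / (2 * κ)) := by
      rw [← Real.rpow_mul hx0.le, ← Real.rpow_add hx0, ← Real.rpow_add hx0, hp_def]
      congr 1
      ring
    have hpow' : x ^ (p + 1 - 1) = x ^ (p - 1) * x := by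
      rw [← Real.rpow_add_one hx0.ne']
      congr 1
      ring
    have hκpow : (2 * κ) ^ s = (2 * κ) ^ (s - 1) * (2 * κ) := by
      rw [← Real.rpow_add_one (by positivity)]
      congr 1
      ring
    rw [abs_neg, abs_of_pos (by positivity), smul_eq_mul, kexp_neg_kexpSubst hκ hx0, kexpSubst,
      Real.div_rpow (by positivity) (by positivity), Real.mul_rpow hx1.le (by positivity), hpow',
      hpow, hκpow]
    field_simp
    ring
  rw [← kexpSubst_image hκ, integral_image_eq_integral_abs_deriv_smul measurableSet_Ioo
    (fun x hx => (hasDerivAt_kexpSubst κ hx.1).hasDerivWithinAt) (injOn_kexpSubst hκ),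
    setIntegral_congr_fun measurableSet_Ioo key, integral_const_mul,
    integral_add (integrableOn_rpow_mul_one_sub_rpow hp hs)
      (integrableOn_rpow_mul_one_sub_rpow (by linarith) hs),
    integral_rpow_mul_one_sub_rpow hp hs, integral_rpow_mul_one_sub_rpow (by linarith) hs,
    Real.Gamma_add_one hp.ne', add_right_comm, Real.Gamma_add_one (by positivity), hpq]
  have hΓ : Real.Gamma (p + s) ≠ 0 := (Real.Gamma_pos_of_pos (by positivity)).ne'
  have hsum : (p + s) * (2 * κ) = 1 + κ * s := by rw [hp_def]; field_simp; ring
  rw [← hsum]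
  field_simp
  linarith

/-- Integral representation of the κ-deformed Gamma function agrees with its closed form. -/
theorem kGamma_integral_repr (κ z : ℝ) (hκ : κ ∈ Set.Ioo (0:ℝ) 1)
    (hz1 : 1 < z) (hz2 : z < 1 + 1/κ) :
    (1 - κ^2 * (z-1)^2) * (z-1) * ∫ t in Set.Ioi (0:ℝ), t ^ (z-2) * kexp κ (-t) =
      ((1 - κ*(z-1)) / (2*κ) ^ (z-1)) *
        (Real.Gamma (1/(2*κ) - (z-1)/2) / Real.Gamma (1/(2*κ) + (z-1)/2)) *
        Real.Gamma z := by
  have hκ0 : 0 < κ := hκ.1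
  have hs : 0 < z - 1 := sub_pos.2 hz1
  have hs' : κ * (z - 1) < 1 := by
    have := mul_lt_mul_of_pos_left (sub_lt_iff_lt_add'.2 hz2) hκ0
    rwa [mul_one_div_cancel hκ0.ne'] at this
  have hΓz : Real.Gamma z = (z - 1) * Real.Gamma (z - 1) := by
    rw [← Real.Gamma_add_one hs.ne', sub_add_cancel]
  have hz : z - 2 = z - 1 - 1 := by ring
  have hΓ : Real.Gamma (1 / (2 * κ) + (z - 1) / 2) ≠ 0 :=
    (Real.Gamma_pos_of_pos (by positivity)).ne'
  rw [hz, integral_rpow_mul_kexp_neg hκ0 hs hs', hΓz]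
  have hne : 1 + κ * (z - 1) ≠ 0 := by positivity
  field_simp
  ring
end

section
/- Let α, ν, β > 0, κ ∈ (0,1) with κ(α/ν − 1) < 1, and let f be the κGG density with these parameters. Then ∫₀^∞ f(x) dx = 1. -/
open Real MeasureTheory Filter Set

theorem kGamma_arg_pos {κ z : ℝ} (hκ : 0 < κ) (hup : κ * (z - 1) < 1) :
    0 < 1 / (2 * κ) - (z - 1) / 2 := by
  rw [show 1 / (2 * κ) - (z - 1) / 2 = (1 - κ * (z - 1)) / (2 * κ) by field_simp]
  exact div_pos (sub_pos.mpr hup) (by positivity)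

theorem kGamma_arg_pos' {κ z : ℝ} (hκ : 0 < κ) (hlow : 0 < 1 + κ * (z - 1)) :
    0 < 1 / (2 * κ) + (z - 1) / 2 := by
  rw [show 1 / (2 * κ) + (z - 1) / 2 = (1 + κ * (z - 1)) / (2 * κ) by field_simp]
  exact div_pos hlow (by positivity)

theorem kGamma_pos {κ z : ℝ} (hκ : 0 < κ) (hz : 0 < z) (hup : κ * (z - 1) < 1)
    (hlow : 0 < 1 + κ * (z - 1)) : 0 < kGamma κ z := by
  have h1 := Real.Gamma_pos_of_pos (kGamma_arg_pos hκ hup)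
  have h2 := Real.Gamma_pos_of_pos (kGamma_arg_pos' hκ hlow)
  have h3 := Real.Gamma_pos_of_pos hz
  have h4 := sub_pos.mpr hup
  unfold kGamma
  positivity

/-- The real Beta integral. -/
theorem integral_Ioo_rpow_mul_one_sub_rpow {a b : ℝ} (ha : 0 < a) (hb : 0 < b) :
    ∫ s in Ioo (0 : ℝ) 1, s ^ (a - 1) * (1 - s) ^ (b - 1) =
      Real.Gamma a * Real.Gamma b / Real.Gamma (a + b) := by
  change _ = ProbabilityTheory.beta a b
  have hB := ProbabilityTheory.beta_pos ha hb
  have h1 := ProbabilityTheory.lintegral_betaPDF_eq_one ha hb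
  rw [ProbabilityTheory.lintegral_betaPDF] at h1
  have h2 : ∫ s in Ioo (0 : ℝ) 1,
      1 / ProbabilityTheory.beta a b * s ^ (a - 1) * (1 - s) ^ (b - 1) = 1 := by
    rw [integral_eq_lintegral_of_nonneg_ae, h1, ENNReal.toReal_one]
    · filter_upwards [ae_restrict_mem measurableSet_Ioo] with s hs
      have := hs.1
      have : 0 < 1 - s := sub_pos.mpr hs.2
      simp only [Pi.zero_apply]
      positivity
    · exact Measurable.aestronglyMeasurable (by fun_prop)
  simp_rw [mul_assoc] at h2
  rw [integral_const_mul] at h2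
  field_simp at h2
  exact h2

/-- The substitution `κ t = sinh u`, `s = exp (-2 u)`, as a map `s ↦ t`. -/
noncomputable def kSubst (κ s : ℝ) : ℝ := (1 - s) / (2 * κ * √s)

theorem kSubst_pos {κ s : ℝ} (hκ : 0 < κ) (hs : s ∈ Ioo (0 : ℝ) 1) : 0 < kSubst κ s := by
  have := Real.sqrt_pos.mpr hs.1
  exact div_pos (sub_pos.mpr hs.2) (by positivity)

theorem sqrt_one_add_kSubst {κ s : ℝ} (hκ : 0 < κ) (hs : 0 < s) :
    √(1 + κ ^ 2 * kSubst κ s ^ 2) = (1 + s) / (2 * √s) := by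
  have h0 := Real.sqrt_pos.mpr hs
  have h2 := Real.sq_sqrt hs.le
  rw [show 1 + κ ^ 2 * kSubst κ s ^ 2 = ((1 + s) / (2 * √s)) ^ 2 by
    unfold kSubst
    field_simp
    rw [h2]
    ring]
  exact Real.sqrt_sq (by positivity)

theorem kexp_neg_kSubst {κ s : ℝ} (hκ : 0 < κ) (hs : 0 < s) :
    kexp κ (-kSubst κ s) = s ^ (1 / (2 * κ)) := by
  have h0 := Real.sqrt_pos.mpr hs
  have h2 := Real.sq_sqrt hs.le
  rw [kexp, neg_sq, sqrt_one_add_kSubst hκ hs]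
  rw [show (1 + s) / (2 * √s) + κ * -kSubst κ s = √s by
    unfold kSubst
    field_simp
    rw [h2]
    ring]
  rw [Real.sqrt_eq_rpow, ← rpow_mul hs.le]
  congr 1
  field_simp

theorem hasDerivAt_kSubst {κ s : ℝ} (hκ : 0 < κ) (hs : 0 < s) :
    HasDerivAt (kSubst κ) (-((1 + s) / (4 * κ * s * √s))) s := by
  have h0 := Real.sqrt_pos.mpr hs
  have h2 := Real.sq_sqrt hs.le
  have h := ((hasDerivAt_id s).const_sub 1).div ((Real.hasDerivAt_sqrt hs.ne').const_mul (2 * κ))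
    (by positivity)
  refine h.congr_deriv ?_
  simp only [id]
  rw [show (2 * κ * √s) ^ 2 = 4 * κ ^ 2 * s by rw [mul_pow, h2]; ring]
  field_simp
  rw [h2]
  ring

theorem injOn_kSubst {κ : ℝ} (hκ : 0 < κ) : InjOn (kSubst κ) (Ioo 0 1) := by
  refine StrictAntiOn.injOn fun s hs t ht hst => ?_
  have := Real.sqrt_pos.mpr hs.1
  exact div_lt_div₀ (by linarith) (by gcongr) (sub_pos.mpr hs.2).le (by positivity)

theorem image_kSubst {κ : ℝ} (hκ : 0 < κ) : kSubst κ '' Ioo 0 1 = Ioi 0 := by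
  ext t
  constructor
  · rintro ⟨s, hs, rfl⟩
    exact kSubst_pos hκ hs
  · intro ht
    have ht : 0 < κ * t := mul_pos hκ ht
    have hr := Real.sq_sqrt (show 0 ≤ 1 + (κ * t) ^ 2 by positivity)
    have hr0 := Real.sqrt_nonneg (1 + (κ * t) ^ 2)
    set r := √(1 + (κ * t) ^ 2)
    have hw0 : 0 < r - κ * t := by nlinarith
    have hw1 : r - κ * t < 1 := by nlinarith
    refine ⟨(r - κ * t) ^ 2, ⟨by positivity, by nlinarith⟩, ?_⟩
    rw [kSubst, Real.sqrt_sq hw0.le, div_eq_iff (by positivity)]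
    linear_combination -hr

/-- The κ-Gamma integral: the Mellin transform of `exp_κ (-t) / √(1 + κ² t²)`. -/
theorem integral_rpow_mul_kexp_div_sqrt {κ z : ℝ} (hκ : 0 < κ) (hz : 0 < z)
    (hup : κ * (z - 1) < 1) (hlow : 0 < 1 + κ * (z - 1)) :
    ∫ t in Ioi (0 : ℝ), t ^ (z - 1) * kexp κ (-t) / √(1 + κ ^ 2 * t ^ 2) =
      kGamma κ z / (1 - κ ^ 2 * (z - 1) ^ 2) := by
  have ha : 0 < 1 / (2 * κ) - (z - 1) / 2 := kGamma_arg_pos hκ hup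
  have hc : 0 < 1 / (2 * κ) + (z - 1) / 2 := kGamma_arg_pos' hκ hlow
  rw [← image_kSubst hκ, integral_image_eq_integral_abs_deriv_smul measurableSet_Ioo
    (fun s hs => (hasDerivAt_kSubst hκ hs.1).hasDerivWithinAt) (injOn_kSubst hκ)]
  have hint : ∀ s ∈ Ioo (0 : ℝ) 1,
      |-((1 + s) / (4 * κ * s * √s))| • (kSubst κ s ^ (z - 1) * kexp κ (-kSubst κ s) /
        √(1 + κ ^ 2 * kSubst κ s ^ 2)) =
      (2 * κ * (2 * κ) ^ (z - 1))⁻¹ *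
        (s ^ (1 / (2 * κ) - (z - 1) / 2 - 1) * (1 - s) ^ (z - 1)) := by
    rintro s ⟨hs0, hs1⟩
    have h0 := Real.sqrt_pos.mpr hs0
    have hpow : kSubst κ s ^ (z - 1) =
        (1 - s) ^ (z - 1) / ((2 * κ) ^ (z - 1) * s ^ ((z - 1) / 2)) := by
      rw [kSubst, div_rpow (sub_nonneg.mpr hs1.le) (by positivity),
        mul_rpow (by positivity) h0.le, Real.sqrt_eq_rpow, ← rpow_mul hs0.le,
        one_div_mul_eq_div]
    rw [abs_neg, abs_of_pos (by positivity), sqrt_one_add_kSubst hκ hs0, kexp_neg_kSubst hκ hs0,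
      hpow, rpow_sub_one hs0.ne', rpow_sub hs0, smul_eq_mul]
    have := rpow_pos_of_pos hs0 ((z - 1) / 2)
    have := rpow_pos_of_pos (show 0 < 2 * κ by positivity) (z - 1)
    generalize s ^ ((z - 1) / 2) = A at *
    generalize s ^ (1 / (2 * κ)) = B at *
    generalize (2 * κ) ^ (z - 1) = C at *
    generalize (1 - s) ^ (z - 1) = D at *
    field_simp
    ring
  rw [setIntegral_congr_fun measurableSet_Ioo hint, integral_const_mul,
    integral_Ioo_rpow_mul_one_sub_rpow ha hz,
    show 1 / (2 * κ) - (z - 1) / 2 + z = 1 / (2 * κ) + (z - 1) / 2 + 1 by ring,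
    Real.Gamma_add_one hc.ne', kGamma]
  have hΓ := (Real.Gamma_pos_of_pos hc).ne'
  have hC := (rpow_pos_of_pos (show 0 < 2 * κ by positivity) (z - 1)).ne'
  rw [show 1 / (2 * κ) + (z - 1) / 2 = (1 + κ * (z - 1)) / (2 * κ) by field_simp] at *
  rw [show 1 - κ ^ 2 * (z - 1) ^ 2 = (1 - κ * (z - 1)) * (1 + κ * (z - 1)) by ring]
  have hup' : 1 - κ * (z - 1) ≠ 0 := (sub_pos.mpr hup).ne'
  generalize Real.Gamma ((1 + κ * (z - 1)) / (2 * κ)) = G at *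
  generalize (2 * κ) ^ (z - 1) = C at *
  generalize Real.Gamma (1 / (2 * κ) - (z - 1) / 2) = H at *
  generalize z - 1 = w at *
  field_simp

/-- The κGG density integrates to one. -/
theorem kGG_integral_eq_one (α ν β κ : ℝ) (hα : 0 < α) (hν : 0 < ν) (hβ : 0 < β)
    (hκ : κ ∈ Set.Ioo (0:ℝ) 1) (h : κ * (α/ν - 1) < 1) :
    ∫ x in Set.Ioi (0:ℝ), kGG α ν β κ x = 1 := by
  obtain ⟨hκ0, hκ1⟩ := hκ
  have hz : 0 < α / ν := div_pos hα hν
  have hlow : 0 < 1 + κ * (α / ν - 1) := by nlinarith [mul_pos hκ0 hz]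
  have hΓκ : kGamma κ (α / ν) ≠ 0 := (kGamma_pos hκ0 hz h hlow).ne'
  let g : ℝ → ℝ := fun t => t ^ (α / ν - 1) * kexp κ (-t) / √(1 + κ ^ 2 * t ^ 2)
  have hsubst : ∫ x in Ioi (0 : ℝ), (ν / β) * (x / β) ^ (ν - 1) * g ((x / β) ^ ν) =
      ∫ t in Ioi (0 : ℝ), g t := by
    rw [← integral_comp_rpow_Ioi_of_pos (g := g) hν]
    have := integral_comp_mul_left_Ioi' (fun y : ℝ => (ν * y ^ (ν - 1)) • g (y ^ ν)) 0
      (inv_pos.mpr hβ)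
    rw [mul_zero, smul_eq_mul, ← integral_const_mul] at this
    rw [← this]
    refine integral_congr_ae (ae_of_all _ fun x => ?_)
    simp only [smul_eq_mul, div_eq_inv_mul]
    ring
  have hcongr : ∫ x in Ioi (0 : ℝ), kGG α ν β κ x = ∫ x in Ioi (0 : ℝ),
      ((1 - κ ^ 2 * (α / ν - 1) ^ 2) * (kGamma κ (α / ν))⁻¹) *
        ((ν / β) * (x / β) ^ (ν - 1) * g ((x / β) ^ ν)) := by
    refine setIntegral_congr_fun measurableSet_Ioi fun x hx => ?_
    have hy : 0 < x / β := div_pos hx hβ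
    have hpow : (x / β) ^ (α - 1) = (x / β) ^ (ν - 1) * ((x / β) ^ ν) ^ (α / ν - 1) := by
      rw [← rpow_mul hy.le, ← rpow_add hy]
      congr 1
      field_simp
      ring
    have hsq : (x / β) ^ (2 * ν) = ((x / β) ^ ν) ^ 2 := by
      rw [mul_comm, rpow_mul hy.le, rpow_two]
    simp only [kGG, g, hpow, hsq]
    ring
  rw [hcongr, integral_const_mul, hsubst, integral_rpow_mul_kexp_div_sqrt hκ0 hz h hlow]
  have : 1 - κ ^ 2 * (α / ν - 1) ^ 2 ≠ 0 := by nlinarith [mul_pos hlow (sub_pos.mpr h)]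
  generalize 1 - κ ^ 2 * (α / ν - 1) ^ 2 = D at *
  field_simp
end

section
/- Let α, ν, β > 0, κ ∈ (0,1) with κ(α/ν − 1) < 1, and let f be the κGG density. Then lim_{x→0⁺} f(x)/x^{α−1} = [1 − κ²(α/ν − 1)²] · ν · β^{−α} · Γ_κ(α/ν)^{−1}; in particular f behaves like the ordinary Generalized Gamma density as x → 0⁺, namely f(x) ∼ x^{α−1}. -/
open Real MeasureTheory Filter Set

theorem tendsto_kexp_neg_rpow_zero {κ ν : ℝ} (hν : 0 < ν) :
    Filter.Tendsto (fun y : ℝ => kexp κ (-(y ^ ν))) (nhds 0) (nhds 1) := by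
  have hpow : ContinuousAt (fun y : ℝ => y ^ ν) 0 :=
    Real.continuousAt_rpow_const 0 ν (Or.inr hν.le)
  have hbase : ContinuousAt
      (fun y : ℝ => Real.sqrt (1 + κ^2 * (-(y ^ ν))^2) + κ * -(y ^ ν)) 0 := by
    fun_prop
  have hexp := hbase.rpow_const (p := 1/κ) (Or.inl (by simp [Real.zero_rpow hν.ne']))
  simpa [ContinuousAt, kexp, Real.zero_rpow hν.ne'] using hexp

theorem tendsto_sqrt_one_add_mul_rpow_zero {c p : ℝ} (hp : 0 < p) :
    Filter.Tendsto (fun y : ℝ => Real.sqrt (1 + c * y ^ p)) (nhds 0) (nhds 1) := by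
  have hpow : ContinuousAt (fun y : ℝ => y ^ p) 0 :=
    Real.continuousAt_rpow_const 0 p (Or.inr hp.le)
  have hsqrt : ContinuousAt (fun y : ℝ => Real.sqrt (1 + c * y ^ p)) 0 := by fun_prop
  simpa [ContinuousAt, Real.zero_rpow hp.ne'] using hsqrt

/-- Behaviour of the κGG density at the origin: `f(x) ∼ x^(α-1)` as `x → 0⁺`. -/
theorem kGG_tendsto_zero (α ν β κ : ℝ) (hα : 0 < α) (hν : 0 < ν) (hβ : 0 < β)
    (hκ : κ ∈ Set.Ioo (0:ℝ) 1) (h : κ * (α/ν - 1) < 1) :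
    Filter.Tendsto (fun x : ℝ => kGG α ν β κ x / x ^ (α-1))
      (nhdsWithin 0 (Set.Ioi 0))
      (nhds ((1 - κ^2*(α/ν - 1)^2) * ν * β ^ (-α) * (kGamma κ (α/ν))⁻¹)) := by
  have hscale : Filter.Tendsto (fun x : ℝ => x / β) (nhdsWithin 0 (Set.Ioi 0)) (nhds 0) := by
    have hcont : Continuous fun x : ℝ => x / β := by fun_prop
    exact (hcont.tendsto' 0 0 (zero_div β)).mono_left nhdsWithin_le_nhds
  have hlim := (((tendsto_kexp_neg_rpow_zero (κ := κ) hν).comp hscale).div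
    ((tendsto_sqrt_one_add_mul_rpow_zero (c := κ^2) (p := 2*ν) (by positivity)).comp hscale)
    one_ne_zero).const_mul ((1 - κ^2*(α/ν - 1)^2) * ν * β ^ (-α) * (kGamma κ (α/ν))⁻¹)
  rw [div_one, mul_one] at hlim
  refine hlim.congr' ?_
  filter_upwards [self_mem_nhdsWithin] with x hx
  have hx : 0 < x := hx
  have hxα : x ^ (α-1) ≠ 0 := (Real.rpow_pos_of_pos hx _).ne'
  have hβα : β ^ (-α) = β⁻¹ * (β ^ (α-1))⁻¹ := by
    rw [← Real.rpow_neg hβ.le, ← Real.rpow_neg_one β, ← Real.rpow_add hβ]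
    ring_nf
  simp only [kGG, Function.comp_apply, Pi.div_apply, Real.div_rpow hx.le hβ.le (α-1), hβα]
  field_simp
end

section
/- Let α, ν, β > 0, κ ∈ (0,1) with κ(α/ν − 1) < 1 and ν/κ + (ν − α) > 1, and let f be the κGG density. Then the mean m = ∫₀^∞ x f(x) dx exists and equals m = β · (2κ)^{−1/ν} · [1 + κ(α/ν − 1)]/[1 + κ((α+1)/ν − 1)] · Γ(1/(2κ) − (α−ν+1)/(2ν))/Γ(1/(2κ) + (α−ν+1)/(2ν)) · Γ(1/(2κ) + (α−ν)/(2ν))/Γ(1/(2κ) − (α−ν)/(2ν)) · Γ((α+1)/ν)/Γ(α/ν). -/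
open Real MeasureTheory Filter Set

/-- The real Beta integral converges on `(0, 1)`, with value `Γ(a) Γ(b) / Γ(a + b)`. -/
lemma integrableOn_and_integral_beta {a b : ℝ} (ha : 0 < a) (hb : 0 < b) :
    IntegrableOn (fun x : ℝ => x ^ (a - 1) * (1 - x) ^ (b - 1)) (Ioo 0 1) ∧
      ∫ x in Ioo (0 : ℝ) 1, x ^ (a - 1) * (1 - x) ^ (b - 1) = ProbabilityTheory.beta a b := by
  have hc : IntegrableOn (fun x : ℝ => (x : ℂ) ^ ((a : ℂ) - 1) * (1 - (x : ℂ)) ^ ((b : ℂ) - 1))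
      (Ioc 0 1) := by
    rw [← intervalIntegrable_iff_integrableOn_Ioc_of_le zero_le_one]
    exact Complex.betaIntegral_convergent (by simpa) (by simpa)
  have hre : ∀ x ∈ Ioc (0 : ℝ) 1,
      ((x : ℂ) ^ ((a : ℂ) - 1) * (1 - (x : ℂ)) ^ ((b : ℂ) - 1)).re =
        x ^ (a - 1) * (1 - x) ^ (b - 1) := by
    rintro x ⟨hx0, hx1⟩
    norm_cast
    rw [← Complex.ofReal_cpow hx0.le, ← Complex.ofReal_cpow (sub_nonneg.2 hx1),
      ← Complex.ofReal_mul, Complex.ofReal_re]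
  refine ⟨(IntegrableOn.congr_fun hc.re hre measurableSet_Ioc).mono_set Ioo_subset_Ioc_self, ?_⟩
  rw [ProbabilityTheory.beta_eq_betaIntegralReal a b ha hb, Complex.betaIntegral,
    intervalIntegral.integral_of_le zero_le_one, ← integral_Ioc_eq_integral_Ioo,
    ← RCLike.re_to_complex, ← integral_re hc]
  exact setIntegral_congr_fun measurableSet_Ioc fun x hx => (hre x hx).symm

/-- The substitution `s ↦ sinh (-log √s) / κ`, written algebraically. -/
noncomputable def sinhSubst (κ s : ℝ) : ℝ := ((√s)⁻¹ - √s) / (2 * κ)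

lemma hasDerivAt_sinhSubst (κ : ℝ) {s : ℝ} (hs : 0 < s) :
    HasDerivAt (sinhSubst κ) (-(s⁻¹ * ((√s)⁻¹ + √s) / (4 * κ))) s := by
  have h0 : √s ≠ 0 := (sqrt_pos.2 hs).ne'
  have h1 := hasDerivAt_sqrt hs.ne'
  refine (((h1.inv h0).sub h1).div_const (2 * κ)).congr_deriv ?_
  nth_rw 4 [← sq_sqrt hs.le]
  field_simp
  ring

lemma antitoneOn_sinhSubst {κ : ℝ} (hκ : 0 < κ) : AntitoneOn (sinhSubst κ) (Ioo 0 1) := by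
  intro s hs t _ hst
  have := sqrt_pos.2 hs.1
  unfold sinhSubst
  gcongr

lemma sqrt_one_add_sinhSubst {κ s : ℝ} (hκ : 0 < κ) (hs : 0 < s) :
    √(1 + κ ^ 2 * sinhSubst κ s ^ 2) = ((√s)⁻¹ + √s) / 2 := by
  have := sqrt_pos.2 hs
  rw [sqrt_eq_iff_mul_self_eq (by positivity) (by positivity)]
  unfold sinhSubst
  field_simp
  ring

lemma image_sinhSubst {κ : ℝ} (hκ : 0 < κ) : sinhSubst κ '' Ioo 0 1 = Ioi 0 := by
  ext t
  constructor
  · rintro ⟨s, ⟨hs0, hs1⟩, rfl⟩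
    have h0 := sqrt_pos.2 hs0
    have h1 : √s < 1 := by rw [sqrt_lt' one_pos]; simpa
    have : 1 < (√s)⁻¹ := (one_lt_inv₀ h0).2 h1
    exact div_pos (sub_pos.2 (h1.trans this)) (by positivity)
  · intro ht
    have ht : 0 < t := ht
    set q := √(1 + κ ^ 2 * t ^ 2)
    have hq2 : q ^ 2 = 1 + κ ^ 2 * t ^ 2 := sq_sqrt (by positivity)
    have hkt : 0 < κ * t := by positivity
    have hq0 : 0 ≤ q := sqrt_nonneg _
    have hr0 : 0 < q - κ * t := by nlinarith
    have hr1 : q - κ * t < 1 := by nlinarith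
    refine ⟨(q - κ * t) ^ 2, ⟨by positivity, by nlinarith⟩, ?_⟩
    have hinv : (q - κ * t)⁻¹ = q + κ * t :=
      inv_eq_of_mul_eq_one_right (by linear_combination hq2)
    rw [sinhSubst, sqrt_sq hr0.le, hinv]
    field_simp
    ring

lemma kexp_neg_sinhSubst {κ s : ℝ} (hκ : 0 < κ) (hs : 0 < s) :
    kexp κ (-sinhSubst κ s) = s ^ (1 / (2 * κ)) := by
  rw [kexp, neg_sq, sqrt_one_add_sinhSubst hκ hs]
  have : ((√s)⁻¹ + √s) / 2 + κ * -sinhSubst κ s = √s := by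
    unfold sinhSubst
    field_simp
    ring
  rw [this, sqrt_eq_rpow, ← rpow_mul hs.le]
  congr 1
  field_simp

lemma sinhSubst_rpow {κ s : ℝ} (hκ : 0 < κ) (hs : s ∈ Ioo (0 : ℝ) 1) (p : ℝ) :
    sinhSubst κ s ^ p = (2 * κ) ^ (-p) * s ^ (-(p / 2)) * (1 - s) ^ p := by
  obtain ⟨hs0, hs1⟩ := hs
  have h0 := sqrt_pos.2 hs0
  have : sinhSubst κ s = (1 - s) / ((2 * κ) * √s) := by
    unfold sinhSubst
    nth_rw 3 [← sq_sqrt hs0.le]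
    field_simp
  rw [this, div_rpow (by linarith) (by positivity), mul_rpow (by positivity) h0.le,
    sqrt_eq_rpow, ← rpow_mul hs0.le, rpow_neg (by positivity), rpow_neg hs0.le,
    show 1 / 2 * p = p / 2 by ring]
  field_simp

/-- The κ-deformed Gamma integral, without its normalising factor. -/
lemma integrableOn_and_integral_rpow_mul_kexp {κ a : ℝ} (hκ : 0 < κ) (ha : 0 < a)
    (hu : 0 < 1 / (2 * κ) - (a - 1) / 2) :
    IntegrableOn (fun t : ℝ => t ^ (a - 1) * kexp κ (-t) / √(1 + κ ^ 2 * t ^ 2)) (Ioi 0) ∧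
      ∫ t in Ioi (0 : ℝ), t ^ (a - 1) * kexp κ (-t) / √(1 + κ ^ 2 * t ^ 2) =
        (2 * κ) ^ (-a) * ProbabilityTheory.beta (1 / (2 * κ) - (a - 1) / 2) a := by
  obtain ⟨h_int, hval⟩ := integrableOn_and_integral_beta hu ha
  have hd : ∀ s ∈ Ioo (0 : ℝ) 1, HasDerivWithinAt (sinhSubst κ)
      (-(s⁻¹ * ((√s)⁻¹ + √s) / (4 * κ))) (Ioo 0 1) s :=
    fun s hs => (hasDerivAt_sinhSubst κ hs.1).hasDerivWithinAt
  have hcongr : ∀ s ∈ Ioo (0 : ℝ) 1,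
      (2 * κ) ^ (-a) * (s ^ (1 / (2 * κ) - (a - 1) / 2 - 1) * (1 - s) ^ (a - 1)) =
      (-(-(s⁻¹ * ((√s)⁻¹ + √s) / (4 * κ)))) •
        (sinhSubst κ s ^ (a - 1) * kexp κ (-sinhSubst κ s) /
          √(1 + κ ^ 2 * sinhSubst κ s ^ 2)) := by
    intro s hs
    have h0 := sqrt_pos.2 hs.1
    rw [sqrt_one_add_sinhSubst hκ hs.1, kexp_neg_sinhSubst hκ hs.1, sinhSubst_rpow hκ hs,
      show 1 / (2 * κ) - (a - 1) / 2 - 1 = 1 / (2 * κ) + -((a - 1) / 2) + -1 by ring,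
      rpow_add hs.1, rpow_add hs.1, rpow_neg_one,
      show -(a - 1) = -a + 1 by ring, rpow_add (by positivity), rpow_one, neg_neg, smul_eq_mul]
    have : (√s)⁻¹ + √s ≠ 0 := by positivity
    generalize (√s)⁻¹ + √s = w at *
    have := hs.1.ne'
    field_simp
    ring
  rw [← image_sinhSubst hκ,
    integrableOn_image_iff_integrableOn_deriv_smul_of_antitoneOn measurableSet_Ioo hd
      (antitoneOn_sinhSubst hκ),
    integral_image_eq_integral_deriv_smul_of_antitoneOn measurableSet_Ioo hd
      (antitoneOn_sinhSubst hκ)]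
  refine ⟨IntegrableOn.congr_fun (h_int.const_mul _) hcongr measurableSet_Ioo, ?_⟩
  rw [← hval, ← integral_const_mul]
  exact (setIntegral_congr_fun measurableSet_Ioo hcongr).symm

lemma mul_kGG_eq {α ν β κ x : ℝ} (hβ : 0 < β) (hν : 0 < ν) (hx : 0 < x) :
    x * kGG α ν β κ x = (1 - κ ^ 2 * (α / ν - 1) ^ 2) * (kGamma κ (α / ν))⁻¹ *
      ((ν * (β⁻¹ * x) ^ (ν - 1)) • (((β⁻¹ * x) ^ ν) ^ ((α + 1) / ν - 1) *
        kexp κ (-((β⁻¹ * x) ^ ν)) / √(1 + κ ^ 2 * ((β⁻¹ * x) ^ ν) ^ 2))) := by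
  obtain ⟨y, hy, rfl⟩ : ∃ y, 0 < y ∧ x = β * y := ⟨x / β, by positivity, by field_simp⟩
  have h1 : β * y / β = y := by field_simp
  have h2 : β⁻¹ * (β * y) = y := by field_simp
  have h3 : (y ^ ν) ^ 2 = y ^ (2 * ν) := by
    rw [← rpow_natCast, ← rpow_mul hy.le, Nat.cast_ofNat, mul_comm]
  have h4 : y * y ^ (α - 1) = y ^ (ν - 1) * (y ^ ν) ^ ((α + 1) / ν - 1) := by
    rw [← rpow_mul hy.le, ← rpow_add hy, rpow_sub_one hy.ne', mul_div_cancel₀ _ hy.ne']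
    congr 1
    field_simp
    ring
  rw [kGG, h1, h2, h3, smul_eq_mul]
  have hββ : β * β⁻¹ = 1 := mul_inv_cancel₀ hβ.ne'
  generalize (kGamma κ (α / ν))⁻¹ = g
  generalize 1 - κ ^ 2 * (α / ν - 1) ^ 2 = c
  generalize kexp κ (-y ^ ν) = e
  simp only [div_eq_mul_inv] at h4 ⊢
  generalize (√(1 + κ ^ 2 * y ^ (2 * ν)))⁻¹ = q
  linear_combination c * g * e * q * ν * h4 + c * ν * g * y * y ^ (α - 1) * e * q * hββ

/-- The mean of the κGG distribution. -/
theorem kGG_mean (α ν β κ : ℝ) (hα : 0 < α) (hν : 0 < ν) (hβ : 0 < β)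
    (hκ : κ ∈ Set.Ioo (0:ℝ) 1) (h : κ * (α/ν - 1) < 1)
    (hmom : 1 < ν/κ + (ν - α)) :
    MeasureTheory.IntegrableOn (fun x : ℝ => x * kGG α ν β κ x) (Set.Ioi 0) ∧
    ∫ x in Set.Ioi (0:ℝ), x * kGG α ν β κ x =
      β * (2*κ) ^ (-(1/ν)) *
      ((1 + κ*(α/ν - 1)) / (1 + κ*((α+1)/ν - 1))) *
      (Real.Gamma (1/(2*κ) - (α-ν+1)/(2*ν)) / Real.Gamma (1/(2*κ) + (α-ν+1)/(2*ν))) *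
      (Real.Gamma (1/(2*κ) + (α-ν)/(2*ν)) / Real.Gamma (1/(2*κ) - (α-ν)/(2*ν))) *
      (Real.Gamma ((α+1)/ν) / Real.Gamma (α/ν)) := by
  obtain ⟨hκ0, hκ1⟩ := hκ
  have hb : 0 < (α + 1) / ν := by positivity
  have ha : 0 < α / ν := by positivity
  have hu : 0 < 1 / (2 * κ) - ((α + 1) / ν - 1) / 2 := by
    have : 1 / (2 * κ) - ((α + 1) / ν - 1) / 2 = (ν / κ + (ν - α) - 1) / (2 * ν) := by
      field_simp
      ring
    rw [this]
    exact div_pos (by linarith) (by linarith)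
  obtain ⟨h_int, hval⟩ := integrableOn_and_integral_rpow_mul_kexp hκ0 hb hu
  have hβ' : 0 < β⁻¹ := inv_pos.2 hβ
  set G : ℝ → ℝ := fun t => t ^ ((α + 1) / ν - 1) * kexp κ (-t) / √(1 + κ ^ 2 * t ^ 2)
  set C := (1 - κ ^ 2 * (α / ν - 1) ^ 2) * (kGamma κ (α / ν))⁻¹ with hC
  have hcongr : ∀ x ∈ Ioi (0 : ℝ), C * ((ν * (β⁻¹ * x) ^ (ν - 1)) • G ((β⁻¹ * x) ^ ν)) =
      x * kGG α ν β κ x := fun x hx => (mul_kGG_eq hβ hν hx).symm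
  constructor
  · refine IntegrableOn.congr_fun (Integrable.const_mul ?_ C) hcongr measurableSet_Ioi
    have h1 := (integrableOn_Ioi_comp_rpow_iff G hν.ne').2 h_int
    rw [abs_of_pos hν] at h1
    exact (integrableOn_Ioi_comp_mul_left_iff (fun y => (ν * y ^ (ν - 1)) • G (y ^ ν)) 0 hβ').2
      (by rwa [mul_zero])
  · rw [← setIntegral_congr_fun measurableSet_Ioi hcongr, integral_const_mul,
      integral_comp_mul_left_Ioi (fun y => (ν * y ^ (ν - 1)) • G (y ^ ν)) 0 hβ', mul_zero,
      integral_comp_rpow_Ioi_of_pos hν, hval, inv_inv, hC, kGamma, ProbabilityTheory.beta,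
      smul_eq_mul]
    have hκb : 0 < 1 + κ * ((α + 1) / ν - 1) := by nlinarith [mul_pos hκ0 hb]
    have hκa : 0 < 1 - κ * (α / ν - 1) := by linarith
    have hΓ : Real.Gamma (1 / (2 * κ) - ((α + 1) / ν - 1) / 2 + (α + 1) / ν) =
        (1 + κ * ((α + 1) / ν - 1)) / (2 * κ) *
          Real.Gamma (1 / (2 * κ) + (α - ν + 1) / (2 * ν)) := by
      have e1 : (1 + κ * ((α + 1) / ν - 1)) / (2 * κ) = 1 / (2 * κ) + (α - ν + 1) / (2 * ν) := by
        field_simp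
        ring
      have e2 : 1 / (2 * κ) - ((α + 1) / ν - 1) / 2 + (α + 1) / ν =
          1 / (2 * κ) + (α - ν + 1) / (2 * ν) + 1 := by
        field_simp
        ring
      rw [e1, e2, Real.Gamma_add_one]
      rw [← e1]
      positivity
    have e3 : 1 / (2 * κ) - ((α + 1) / ν - 1) / 2 = 1 / (2 * κ) - (α - ν + 1) / (2 * ν) := by
      field_simp
      ring
    have e4 : (α / ν - 1) / 2 = (α - ν) / (2 * ν) := by
      field_simp
    have e5 : (2 * κ) ^ (-((α + 1) / ν)) =
        (2 * κ) ^ (-(1 / ν)) * ((2 * κ) ^ (α / ν - 1))⁻¹ * (2 * κ)⁻¹ := by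
      rw [← rpow_neg (by positivity), ← rpow_neg_one (2 * κ), ← rpow_add (by positivity),
        ← rpow_add (by positivity)]
      congr 1
      ring
    have e6 : 1 - κ ^ 2 * (α / ν - 1) ^ 2 =
        (1 - κ * (α / ν - 1)) * (1 + κ * (α / ν - 1)) := by ring
    rw [hΓ, e3, e4, e5, e6]
    have hp : (2 * κ) ^ (α / ν - 1) ≠ 0 := by positivity
    generalize (2 * κ) ^ (α / ν - 1) = p at *
    generalize 1 + κ * (α / ν - 1) = A at *
    generalize 1 - κ * (α / ν - 1) = B at *
    generalize 1 + κ * ((α + 1) / ν - 1) = D at *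
    have hB := hκa.ne'
    simp only [mul_inv, div_eq_mul_inv, inv_inv]
    field_simp
end

section
/- (Appendix Theorem.) Let f and g be probability densities on (0,∞) with finite positive means m_f = ∫₀^∞ t f(t) dt and m_g = ∫₀^∞ t g(t) dt, and assume their cumulative distribution functions F(x) = ∫₀^x f and G(x) = ∫₀^x g are strictly increasing and continuous on (0,∞). Then the following are equivalent: (i) for all x, y > 0 with F(x) = G(y), one has (1/m_f)∫₀^x t f(t) dt ≥ (1/m_g)∫₀^y t g(t) dt (i.e. X ≤_L Y, the Lorenz curve of f lies above that of g); (ii) for every continuous convex function ψ : [0,∞) → ℝ for which both integrals exist, ∫₀^∞ ψ(t/m_f) f(t) dt ≤ ∫₀^∞ ψ(t/m_g) g(t) dt. -/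
open Real MeasureTheory Filter Set

/-- `f` restricted to `(0, ∞)` is a probability density with finite positive mean `m`. -/
structure IsDensityWithMean (f : ℝ → ℝ) (m : ℝ) : Prop where
  nonneg : ∀ x ∈ Ioi (0 : ℝ), 0 ≤ f x
  integrable : IntegrableOn f (Ioi 0)
  integral_eq_one : ∫ t in Ioi (0 : ℝ), f t = 1
  integrable_id_mul : IntegrableOn (fun t => t * f t) (Ioi 0)
  integral_id_mul : ∫ t in Ioi (0 : ℝ), t * f t = m
  mean_pos : 0 < m

namespace IsDensityWithMean

variable {f g : ℝ → ℝ} {m mf mg : ℝ}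

theorem integrable_affine_mul (hf : IsDensityWithMean f m) (a b : ℝ) :
    IntegrableOn (fun t => (a * (t / m) + b) * f t) (Ioi 0) := by
  have h := (hf.integrable_id_mul.const_mul (a / m)).add (hf.integrable.const_mul b)
  refine h.congr (Eventually.of_forall fun t => ?_)
  simp only [Pi.add_apply]
  ring

theorem setIntegral_affine_mul (hf : IsDensityWithMean f m) (a b : ℝ) {s : Set ℝ}
    (hs : s ⊆ Ioi 0) :
    ∫ t in s, (a * (t / m) + b) * f t =
      a * (1 / m * ∫ t in s, t * f t) + b * ∫ t in s, f t := by
  rw [← integral_const_mul, ← integral_const_mul, ← integral_const_mul, ← integral_add]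
  · congr 1 with t
    ring
  · exact ((hf.integrable_id_mul.mono_set hs).const_mul _).const_mul _
  · exact (hf.integrable.mono_set hs).const_mul _

theorem integral_affine_mul (hf : IsDensityWithMean f m) (a b : ℝ) :
    ∫ t in Ioi (0 : ℝ), (a * (t / m) + b) * f t = a + b := by
  rw [hf.setIntegral_affine_mul a b subset_rfl, hf.integral_id_mul, hf.integral_eq_one,
    one_div_mul_cancel hf.mean_pos.ne', mul_one, mul_one]

theorem integrable_max_affine_mul (hf : IsDensityWithMean f m) (a b : ℝ) :
    IntegrableOn (fun t => max (a * (t / m) + b) 0 * f t) (Ioi 0) := by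
  refine IntegrableOn.congr_fun (hf.integrable_affine_mul a b).pos_part (fun t ht => ?_)
    measurableSet_Ioi
  simp only [max_mul_of_nonneg _ _ (hf.nonneg t ht), zero_mul]

theorem integral_Ioi_sub_mul (hf : IsDensityWithMean f m) (k : ℝ) {x : ℝ} (hx : 0 ≤ x) :
    ∫ t in Ioi x, (1 * (t / m) + -k) * f t =
      1 - (1 / m * ∫ t in Ioc 0 x, t * f t) - k * (1 - ∫ t in Ioc 0 x, f t) := by
  have hd : Disjoint (Ioc 0 x) (Ioi x) := Ioc_disjoint_Ioi le_rfl
  have hu : Ioc 0 x ∪ Ioi x = Ioi 0 := Ioc_union_Ioi_eq_Ioi hx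
  have hi := hf.integrable_affine_mul 1 (-k)
  have h := setIntegral_union hd measurableSet_Ioi (hi.mono_set Ioc_subset_Ioi_self)
    (hi.mono_set (Ioi_subset_Ioi hx))
  rw [hu, hf.integral_affine_mul, hf.setIntegral_affine_mul _ _ Ioc_subset_Ioi_self] at h
  linarith

theorem le_integral_hinge (hf : IsDensityWithMean f m) (k : ℝ) {x : ℝ} (hx : 0 ≤ x) :
    1 - (1 / m * ∫ t in Ioc 0 x, t * f t) - k * (1 - ∫ t in Ioc 0 x, f t) ≤
      ∫ t in Ioi (0 : ℝ), max (1 * (t / m) + -k) 0 * f t := by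
  rw [← hf.integral_Ioi_sub_mul k hx]
  have hi := hf.integrable_max_affine_mul 1 (-k)
  calc ∫ t in Ioi x, (1 * (t / m) + -k) * f t
      ≤ ∫ t in Ioi x, max (1 * (t / m) + -k) 0 * f t := by
        refine setIntegral_mono_on ((hf.integrable_affine_mul 1 (-k)).mono_set
          (Ioi_subset_Ioi hx)) (hi.mono_set (Ioi_subset_Ioi hx)) measurableSet_Ioi
          fun t ht => ?_
        exact mul_le_mul_of_nonneg_right (le_max_left _ _) (hf.nonneg t (hx.trans_lt ht))
    _ ≤ _ := by
        refine setIntegral_mono_set hi ?_ (Ioi_subset_Ioi hx).eventuallyLE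
        filter_upwards [ae_restrict_mem measurableSet_Ioi] with t ht
        exact mul_nonneg (le_max_right _ _) (hf.nonneg t ht)

theorem integral_hinge (hf : IsDensityWithMean f m) {x : ℝ} (hx : 0 ≤ x) :
    ∫ t in Ioi (0 : ℝ), max (1 * (t / m) + -(x / m)) 0 * f t =
      1 - (1 / m * ∫ t in Ioc 0 x, t * f t) - x / m * (1 - ∫ t in Ioc 0 x, f t) := by
  rw [← hf.integral_Ioi_sub_mul (x / m) hx]
  have hm := hf.mean_pos
  rw [setIntegral_eq_of_subset_of_forall_sdiff_eq_zero measurableSet_Ioi (Ioi_subset_Ioi hx)]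
  · refine setIntegral_congr_fun measurableSet_Ioi fun t ht => ?_
    have : x / m ≤ t / m := div_le_div_of_nonneg_right (le_of_lt ht) hm.le
    simp only [max_eq_left (by linarith : (0 : ℝ) ≤ 1 * (t / m) + -(x / m))]
  · rintro t ⟨-, ht⟩
    have : t / m ≤ x / m := div_le_div_of_nonneg_right (not_lt.1 ht) hm.le
    rw [max_eq_right (by linarith), zero_mul]

theorem exists_integral_Ioc_eq (hg : IsDensityWithMean g m) {p : ℝ} (hp₀ : 0 < p) (hp₁ : p < 1) :
    ∃ y, 0 < y ∧ ∫ t in Ioc 0 y, g t = p := by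
  have hlim : Tendsto (fun y : ℝ => ∫ t in (0 : ℝ)..y, g t) atTop (nhds 1) :=
    hg.integral_eq_one ▸ intervalIntegral_tendsto_integral_Ioi 0 hg.integrable tendsto_id
  obtain ⟨Y, hYp, hY⟩ := ((hlim.eventually_const_lt hp₁).and (eventually_ge_atTop 0)).exists
  rw [intervalIntegral.integral_of_le hY] at hYp
  have hcont : ContinuousOn (fun y => ∫ t in Ioc 0 y, g t) (Icc 0 Y) :=
    intervalIntegral.continuousOn_primitive
      (integrableOn_Icc_iff_integrableOn_Ioc (by finiteness) |>.2 (hg.integrable.mono_set Ioc_subset_Ioi_self))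
  obtain ⟨y, hy, hyp⟩ := intermediate_value_Icc hY hcont
    (show p ∈ Icc _ _ from ⟨by simpa using hp₀.le, hYp.le⟩)
  refine ⟨y, hy.1.lt_of_ne ?_, hyp⟩
  rintro rfl
  simp [hp₀.ne] at hyp

theorem integral_Ioc_mem_Ioo (hf : IsDensityWithMean f m)
    (hF : StrictMonoOn (fun x => ∫ t in Ioc (0 : ℝ) x, f t) (Ioi 0)) {x : ℝ} (hx : 0 < x) :
    ∫ t in Ioc 0 x, f t ∈ Ioo (0 : ℝ) 1 := by
  constructor
  · refine lt_of_le_of_lt ?_ (hF (half_pos hx) hx (half_lt_self hx))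
    exact setIntegral_nonneg measurableSet_Ioc fun t ht => hf.nonneg t ht.1
  · refine lt_of_lt_of_le (hF hx (hx.trans (lt_add_one x)) (lt_add_one x)) ?_
    refine hf.integral_eq_one ▸ setIntegral_mono_set hf.integrable ?_
      Ioc_subset_Ioi_self.eventuallyLE
    filter_upwards [ae_restrict_mem measurableSet_Ioi] with t ht using hf.nonneg t ht

theorem integral_hinge_le (hf : IsDensityWithMean f mf) (hg : IsDensityWithMean g mg)
    (hF : StrictMonoOn (fun x => ∫ t in Ioc (0 : ℝ) x, f t) (Ioi 0))
    (hL : ∀ x y : ℝ, 0 < x → 0 < y → ∫ t in Ioc 0 x, f t = ∫ t in Ioc 0 y, g t →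
      1 / mg * ∫ t in Ioc 0 y, t * g t ≤ 1 / mf * ∫ t in Ioc 0 x, t * f t)
    {k : ℝ} (hk : 0 < k) :
    ∫ t in Ioi (0 : ℝ), max (1 * (t / mf) + -k) 0 * f t ≤
      ∫ t in Ioi (0 : ℝ), max (1 * (t / mg) + -k) 0 * g t := by
  have hx : 0 < k * mf := mul_pos hk hf.mean_pos
  obtain ⟨h₀, h₁⟩ := hf.integral_Ioc_mem_Ioo hF hx
  obtain ⟨y, hy, hxy⟩ := hg.exists_integral_Ioc_eq h₀ h₁
  have h := hf.integral_hinge hx.le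
  rw [mul_div_cancel_right₀ _ hf.mean_pos.ne'] at h
  rw [h]
  refine le_trans ?_ (hg.le_integral_hinge k hy.le)
  rw [hxy]
  linarith [hL _ _ hx hy hxy.symm]

theorem integral_max_affine_le (hf : IsDensityWithMean f mf) (hg : IsDensityWithMean g mg)
    (hF : StrictMonoOn (fun x => ∫ t in Ioc (0 : ℝ) x, f t) (Ioi 0))
    (hL : ∀ x y : ℝ, 0 < x → 0 < y → ∫ t in Ioc 0 x, f t = ∫ t in Ioc 0 y, g t →
      1 / mg * ∫ t in Ioc 0 y, t * g t ≤ 1 / mf * ∫ t in Ioc 0 x, t * f t)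
    {a : ℝ} (ha : 0 ≤ a) (b : ℝ) :
    ∫ t in Ioi (0 : ℝ), max (a * (t / mf) + b) 0 * f t ≤
      ∫ t in Ioi (0 : ℝ), max (a * (t / mg) + b) 0 * g t := by
  rcases le_or_gt 0 b with hb | hb
  · have key : ∀ {h : ℝ → ℝ} {m : ℝ}, IsDensityWithMean h m →
        ∫ t in Ioi (0 : ℝ), max (a * (t / m) + b) 0 * h t = a + b := fun {h m} hh => by
      rw [← hh.integral_affine_mul a b]
      refine setIntegral_congr_fun measurableSet_Ioi fun t (ht : 0 < t) => ?_
      have := hh.mean_pos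
      simp only [max_eq_left (by positivity : 0 ≤ a * (t / m) + b)]
    rw [key hf, key hg]
  rcases ha.eq_or_lt with rfl | ha
  · simp [max_eq_right hb.le]
  have key : ∀ (h : ℝ → ℝ) (m : ℝ), ∫ t in Ioi (0 : ℝ), max (a * (t / m) + b) 0 * h t =
      a * ∫ t in Ioi (0 : ℝ), max (1 * (t / m) + -(-b / a)) 0 * h t := fun h m => by
    rw [← integral_const_mul]
    congr 1 with t
    rw [← mul_assoc, mul_max_of_nonneg _ _ ha.le, mul_zero]
    congr 2
    field_simp
  rw [key, key]
  exact mul_le_mul_of_nonneg_left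
    (hf.integral_hinge_le hg hF hL (div_pos (neg_pos.2 hb) ha)) ha.le

end IsDensityWithMean

/-- A piecewise affine function built from the lines `u ↦ s i * u + c i`. It is their maximum when
they are successive tangents to a convex function. -/
noncomputable def tangentEnvelope (s c : ℕ → ℝ) (n : ℕ) (u : ℝ) : ℝ :=
  s 0 * u + c 0 + ∑ i ∈ Finset.range n, max ((s (i + 1) - s i) * u + (c (i + 1) - c i)) 0

theorem tangentEnvelope_succ (s c : ℕ → ℝ) (n : ℕ) (u : ℝ) :
    tangentEnvelope s c (n + 1) u =
      tangentEnvelope s c n u + max ((s (n + 1) - s n) * u + (c (n + 1) - c n)) 0 := by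
  simp only [tangentEnvelope, Finset.sum_range_succ, add_assoc]

theorem le_tangentEnvelope (s c : ℕ → ℝ) (u : ℝ) {i n : ℕ} (hi : i ≤ n) :
    s i * u + c i ≤ tangentEnvelope s c n u := by
  induction n generalizing i with
  | zero => simp [Nat.le_zero.1 hi, tangentEnvelope]
  | succ n ih =>
    rw [tangentEnvelope_succ]
    rcases hi.eq_or_lt with rfl | hi
    · linarith [ih (le_refl n), le_max_left ((s (n + 1) - s n) * u + (c (n + 1) - c n)) 0]
    · linarith [ih (Nat.lt_succ_iff.1 hi),
        le_max_right ((s (n + 1) - s n) * u + (c (n + 1) - c n)) 0]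

/-- `s x` is a subgradient at `x` of the function `ψ` on `[0, ∞)`, for every `x > 0`. -/
def IsSubgradient (ψ s : ℝ → ℝ) : Prop :=
  ∀ x, 0 < x → ∀ y, 0 ≤ y → ψ x + s x * (y - x) ≤ ψ y

theorem ConvexOn.exists_isSubgradient {ψ : ℝ → ℝ} (hψ : ConvexOn ℝ (Ici 0) ψ) :
    ∃ s, IsSubgradient ψ s := by
  refine ⟨fun x => derivWithin ψ (Ioi x) x, fun x hx y hy => ?_⟩
  have hxi : x ∈ interior (Ici (0 : ℝ)) := by rwa [interior_Ici]
  rcases lt_trichotomy x y with h | rfl | h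
  · have := hψ.rightDeriv_le_slope_of_mem_interior hxi hy h
    rw [slope_def_field, le_div_iff₀ (sub_pos.2 h)] at this
    linarith
  · simp
  · have := (hψ.slope_le_leftDeriv_of_mem_interior hy hxi h).trans
      (hψ.leftDeriv_le_rightDeriv_of_mem_interior hxi)
    rw [slope_def_field, div_le_iff₀ (sub_pos.2 h)] at this
    linarith

namespace IsSubgradient

variable {ψ s : ℝ → ℝ}

theorem monotoneOn (hs : IsSubgradient ψ s) : MonotoneOn s (Ioi 0) := by
  intro x hx y hy hxy
  rcases hxy.eq_or_lt with rfl | h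
  · rfl
  · refine le_of_mul_le_mul_right ?_ (sub_pos.2 h)
    linarith [hs x hx y (le_of_lt hy), hs y hy x (le_of_lt hx)]

theorem tangentEnvelope_le_and_eq (hs : IsSubgradient ψ s) {x : ℕ → ℝ} (hx : Monotone x)
    (hx₀ : ∀ i, 0 < x i) {u : ℝ} (hu : 0 ≤ u) (n : ℕ) :
    tangentEnvelope (fun i => s (x i)) (fun i => ψ (x i) - s (x i) * x i) n u ≤ ψ u ∧
      (x n ≤ u → tangentEnvelope (fun i => s (x i)) (fun i => ψ (x i) - s (x i) * x i) n u =
        s (x n) * u + (ψ (x n) - s (x n) * x n)) := by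
  induction n with
  | zero =>
    simp only [tangentEnvelope, Finset.range_zero, Finset.sum_empty, add_zero, implies_true,
      and_true]
    linarith [hs _ (hx₀ 0) u hu]
  | succ n ih =>
    obtain ⟨ih_le, ih_eq⟩ := ih
    have hle := hx n.le_succ
    have hmono := hs.monotoneOn (hx₀ n) (hx₀ (n + 1)) hle
    have h₁ := hs _ (hx₀ n) _ (hx₀ (n + 1)).le
    have h₂ := hs _ (hx₀ (n + 1)) _ (hx₀ n).le
    have hu₂ := hs _ (hx₀ (n + 1)) u hu
    rw [tangentEnvelope_succ]
    constructor
    · rcases le_total (x n) u with h | h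
      · rw [ih_eq h]
        have hu₁ := hs _ (hx₀ n) u hu
        rcases max_cases ((s (x (n + 1)) - s (x n)) * u +
          (ψ (x (n + 1)) - s (x (n + 1)) * x (n + 1) - (ψ (x n) - s (x n) * x n))) 0 with
          ⟨e, -⟩ | ⟨e, -⟩ <;> rw [e] <;> linarith
      · rw [max_eq_right]
        · linarith
        · nlinarith [mul_nonneg (sub_nonneg.2 hmono) (sub_nonneg.2 h)]
    · intro h
      rw [ih_eq (hle.trans h), max_eq_left]
      · ring
      · nlinarith [mul_nonneg (sub_nonneg.2 hmono) (sub_nonneg.2 h)]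

end IsSubgradient

namespace IsDensityWithMean

variable {f g : ℝ → ℝ} {m mf mg : ℝ}

theorem integrable_tangentEnvelope_mul (hf : IsDensityWithMean f m) (s c : ℕ → ℝ) (n : ℕ) :
    IntegrableOn (fun t => tangentEnvelope s c n (t / m) * f t) (Ioi 0) := by
  induction n with
  | zero => simpa [tangentEnvelope] using hf.integrable_affine_mul (s 0) (c 0)
  | succ n ih =>
    simp only [tangentEnvelope_succ, add_mul]
    exact ih.add (hf.integrable_max_affine_mul _ _)

theorem integral_tangentEnvelope_le (hf : IsDensityWithMean f mf) (hg : IsDensityWithMean g mg)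
    (hF : StrictMonoOn (fun x => ∫ t in Ioc (0 : ℝ) x, f t) (Ioi 0))
    (hL : ∀ x y : ℝ, 0 < x → 0 < y → ∫ t in Ioc 0 x, f t = ∫ t in Ioc 0 y, g t →
      1 / mg * ∫ t in Ioc 0 y, t * g t ≤ 1 / mf * ∫ t in Ioc 0 x, t * f t)
    {s : ℕ → ℝ} (hs : Monotone s) (c : ℕ → ℝ) (n : ℕ) :
    ∫ t in Ioi (0 : ℝ), tangentEnvelope s c n (t / mf) * f t ≤
      ∫ t in Ioi (0 : ℝ), tangentEnvelope s c n (t / mg) * g t := by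
  induction n with
  | zero =>
    simp only [tangentEnvelope, Finset.range_zero, Finset.sum_empty, add_zero,
      hf.integral_affine_mul, hg.integral_affine_mul, le_refl]
  | succ n ih =>
    have key : ∀ {h : ℝ → ℝ} {m : ℝ}, IsDensityWithMean h m →
        ∫ t in Ioi (0 : ℝ), tangentEnvelope s c (n + 1) (t / m) * h t =
          (∫ t in Ioi (0 : ℝ), tangentEnvelope s c n (t / m) * h t) + ∫ t in Ioi (0 : ℝ),
            max ((s (n + 1) - s n) * (t / m) + (c (n + 1) - c n)) 0 * h t := fun {h m} hh => by
      rw [← integral_add (hh.integrable_tangentEnvelope_mul s c n)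
        (hh.integrable_max_affine_mul _ _)]
      simp only [tangentEnvelope_succ, add_mul]
    rw [key hf, key hg]
    exact add_le_add ih
      (hf.integral_max_affine_le hg hF hL (sub_nonneg.2 (hs n.le_succ)) _)

end IsDensityWithMean

/-- The uniform grid on `(0, ∞)` of mesh `1 / (N + 1)`. -/
noncomputable def uniformGrid (N i : ℕ) : ℝ := ((i : ℝ) + 1) / ((N : ℝ) + 1)

theorem uniformGrid_monotone (N : ℕ) : Monotone (uniformGrid N) := by
  intro i j hij
  unfold uniformGrid
  gcongr

theorem uniformGrid_pos (N i : ℕ) : 0 < uniformGrid N i := by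
  unfold uniformGrid
  positivity

theorem uniformGrid_self (N : ℕ) : uniformGrid N N = 1 :=
  div_self (by positivity)

/-- The envelope of the tangents to `ψ` at the points of the uniform grid of mesh `1 / (N + 1)`
in `(0, N + 1]`. -/
noncomputable def gridEnvelope (ψ s : ℝ → ℝ) (N : ℕ) (u : ℝ) : ℝ :=
  tangentEnvelope (fun i => s (uniformGrid N i))
    (fun i => ψ (uniformGrid N i) - s (uniformGrid N i) * uniformGrid N i) ((N + 1) ^ 2) u

namespace IsSubgradient

variable {ψ s : ℝ → ℝ}

theorem gridEnvelope_le (hs : IsSubgradient ψ s) (N : ℕ) {u : ℝ} (hu : 0 ≤ u) :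
    gridEnvelope ψ s N u ≤ ψ u :=
  (hs.tangentEnvelope_le_and_eq (uniformGrid_monotone N) (uniformGrid_pos N) hu _).1

end IsSubgradient

theorem tangent_le_gridEnvelope (ψ s : ℝ → ℝ) (N : ℕ) (u : ℝ) {i : ℕ} (hi : i ≤ (N + 1) ^ 2) :
    ψ (uniformGrid N i) + s (uniformGrid N i) * (u - uniformGrid N i) ≤ gridEnvelope ψ s N u := by
  refine le_trans (le_of_eq ?_) (le_tangentEnvelope _ _ u hi)
  ring

theorem tangent_one_le_gridEnvelope (ψ s : ℝ → ℝ) (N : ℕ) (u : ℝ) :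
    ψ 1 + s 1 * (u - 1) ≤ gridEnvelope ψ s N u := by
  have h := tangent_le_gridEnvelope ψ s N u (i := N) (by nlinarith)
  rwa [uniformGrid_self] at h

theorem exists_uniformGrid_tendsto {u : ℝ} (hu : 0 < u) :
    ∃ p : ℕ → ℝ, Tendsto p atTop (nhds u) ∧
      ∀ᶠ N in atTop, p N ≤ u ∧ ∃ i ≤ (N + 1) ^ 2, p N = uniformGrid N i := by
  have hcast : Tendsto (fun N : ℕ => (N : ℝ) + 1) atTop atTop :=
    tendsto_atTop_add_const_right _ _ tendsto_natCast_atTop_atTop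
  refine ⟨fun N => (⌊u * ((N : ℝ) + 1)⌋₊ : ℝ) / ((N : ℝ) + 1),
    (tendsto_nat_floor_mul_div_atTop hu.le).comp hcast, ?_⟩
  filter_upwards [hcast.eventually_ge_atTop u, hcast.eventually_ge_atTop (1 / u)] with N h₁ h₂
  have hN : (0 : ℝ) < (N : ℝ) + 1 := by positivity
  have hfloor : (⌊u * ((N : ℝ) + 1)⌋₊ : ℝ) ≤ u * ((N : ℝ) + 1) := Nat.floor_le (by positivity)
  have hpos : 1 ≤ ⌊u * ((N : ℝ) + 1)⌋₊ := by
    rw [Nat.one_le_floor_iff]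
    rwa [div_le_iff₀' hu] at h₂
  refine ⟨(div_le_iff₀ hN).2 hfloor, ⌊u * ((N : ℝ) + 1)⌋₊ - 1, ?_, ?_⟩
  · refine (Nat.sub_le _ _).trans ?_
    have : (⌊u * ((N : ℝ) + 1)⌋₊ : ℝ) ≤ ((N : ℝ) + 1) ^ 2 := by nlinarith
    exact_mod_cast this
  · rw [uniformGrid, Nat.cast_sub hpos, Nat.cast_one, sub_add_cancel]

theorem IsSubgradient.tendsto_gridEnvelope {ψ s : ℝ → ℝ} (hs : IsSubgradient ψ s)
    (hψ : ContinuousOn ψ (Ici 0)) {u : ℝ} (hu : 0 < u) :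
    Tendsto (fun N => gridEnvelope ψ s N u) atTop (nhds (ψ u)) := by
  obtain ⟨p, hp, hgrid⟩ := exists_uniformGrid_tendsto hu
  have hlower : Tendsto (fun N => ψ (p N) + s (u / 2) * (u - p N)) atTop (nhds (ψ u)) := by
    have h := ((hψ.continuousAt (Ici_mem_nhds hu)).tendsto.comp hp).add
      ((hp.const_sub u).const_mul (s (u / 2)))
    simpa using h
  refine tendsto_of_tendsto_of_tendsto_of_le_of_le' hlower tendsto_const_nhds ?_
    (Eventually.of_forall fun N => hs.gridEnvelope_le N hu.le)
  filter_upwards [hgrid, hp.eventually_const_lt (half_lt_self hu)] with N hN hlt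
  obtain ⟨hle, i, hi, hpi⟩ := hN
  refine le_trans ?_ (tangent_le_gridEnvelope ψ s N u hi)
  rw [← hpi]
  have hmono := hs.monotoneOn (half_pos hu) ((half_pos hu).trans hlt) hlt.le
  linarith [mul_le_mul_of_nonneg_right hmono (sub_nonneg.2 hle)]

theorem IsDensityWithMean.integral_convex_le {f g : ℝ → ℝ} {mf mg : ℝ}
    (hf : IsDensityWithMean f mf) (hg : IsDensityWithMean g mg)
    (hF : StrictMonoOn (fun x => ∫ t in Ioc (0 : ℝ) x, f t) (Ioi 0))
    (hL : ∀ x y : ℝ, 0 < x → 0 < y → ∫ t in Ioc 0 x, f t = ∫ t in Ioc 0 y, g t →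
      1 / mg * ∫ t in Ioc 0 y, t * g t ≤ 1 / mf * ∫ t in Ioc 0 x, t * f t)
    {ψ : ℝ → ℝ} (hψ : ContinuousOn ψ (Ici 0)) (hconv : ConvexOn ℝ (Ici 0) ψ)
    (hψf : IntegrableOn (fun t => ψ (t / mf) * f t) (Ioi 0))
    (hψg : IntegrableOn (fun t => ψ (t / mg) * g t) (Ioi 0)) :
    ∫ t in Ioi (0 : ℝ), ψ (t / mf) * f t ≤ ∫ t in Ioi (0 : ℝ), ψ (t / mg) * g t := by
  obtain ⟨s, hs⟩ := hconv.exists_isSubgradient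
  have hmf := hf.mean_pos
  have hmg := hg.mean_pos
  have hlim : Tendsto (fun N => ∫ t in Ioi (0 : ℝ), gridEnvelope ψ s N (t / mf) * f t) atTop
      (nhds (∫ t in Ioi (0 : ℝ), ψ (t / mf) * f t)) := by
    refine tendsto_integral_of_dominated_convergence
      (fun t => |ψ (t / mf) * f t| + |(s 1 * (t / mf) + (ψ 1 - s 1)) * f t|)
      (fun N => (hf.integrable_tangentEnvelope_mul _ _ _).aestronglyMeasurable)
      (hψf.abs.add (hf.integrable_affine_mul _ _).abs) (fun N => ?_) ?_
    · filter_upwards [ae_restrict_mem measurableSet_Ioi] with t (ht : 0 < t)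
      have hft := hf.nonneg t ht
      have hupper := mul_le_mul_of_nonneg_right
        (hs.gridEnvelope_le N (by positivity : 0 ≤ t / mf)) hft
      have hlower : (s 1 * (t / mf) + (ψ 1 - s 1)) * f t ≤ gridEnvelope ψ s N (t / mf) * f t :=
        mul_le_mul_of_nonneg_right
          (by linarith [tangent_one_le_gridEnvelope ψ s N (t / mf)]) hft
      rw [Real.norm_eq_abs, abs_le]
      constructor
      · linarith [neg_abs_le ((s 1 * (t / mf) + (ψ 1 - s 1)) * f t), abs_nonneg (ψ (t / mf) * f t)]
      · linarith [le_abs_self (ψ (t / mf) * f t),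
          abs_nonneg ((s 1 * (t / mf) + (ψ 1 - s 1)) * f t)]
    · filter_upwards [ae_restrict_mem measurableSet_Ioi] with t (ht : 0 < t)
      exact (hs.tendsto_gridEnvelope hψ (div_pos ht hmf)).mul_const _
  refine le_of_tendsto' hlim fun N => ?_
  refine (hf.integral_tangentEnvelope_le hg hF hL (fun i j hij => hs.monotoneOn
    (uniformGrid_pos N i) (uniformGrid_pos N j) (uniformGrid_monotone N hij)) _ _).trans ?_
  refine setIntegral_mono_on (hg.integrable_tangentEnvelope_mul _ _ _) hψg measurableSet_Ioi
    fun t (ht : 0 < t) => ?_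
  exact mul_le_mul_of_nonneg_right (hs.gridEnvelope_le N (by positivity)) (hg.nonneg t ht)

/-- Appendix theorem: Lorenz ordering is equivalent to the ordering of expectations of
continuous convex functions of the normalized variable. -/
theorem lorenz_order_iff_convex_order
    (f g : ℝ → ℝ) (mf mg : ℝ)
    (hf_nonneg : ∀ x ∈ Set.Ioi (0:ℝ), 0 ≤ f x)
    (hg_nonneg : ∀ x ∈ Set.Ioi (0:ℝ), 0 ≤ g x)
    (hf_int : MeasureTheory.IntegrableOn f (Set.Ioi 0))
    (hg_int : MeasureTheory.IntegrableOn g (Set.Ioi 0))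
    (hf_prob : ∫ t in Set.Ioi (0:ℝ), f t = 1)
    (hg_prob : ∫ t in Set.Ioi (0:ℝ), g t = 1)
    (hf_mean_int : MeasureTheory.IntegrableOn (fun t => t * f t) (Set.Ioi 0))
    (hg_mean_int : MeasureTheory.IntegrableOn (fun t => t * g t) (Set.Ioi 0))
    (hmf : mf = ∫ t in Set.Ioi (0:ℝ), t * f t) (hmf_pos : 0 < mf)
    (hmg : mg = ∫ t in Set.Ioi (0:ℝ), t * g t) (hmg_pos : 0 < mg)
    (hF_mono : StrictMonoOn (fun x => ∫ t in Set.Ioc (0:ℝ) x, f t) (Set.Ioi 0))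
    (hG_mono : StrictMonoOn (fun x => ∫ t in Set.Ioc (0:ℝ) x, g t) (Set.Ioi 0))
    (hF_cont : ContinuousOn (fun x => ∫ t in Set.Ioc (0:ℝ) x, f t) (Set.Ioi 0))
    (hG_cont : ContinuousOn (fun x => ∫ t in Set.Ioc (0:ℝ) x, g t) (Set.Ioi 0)) :
    ( ∀ x y : ℝ, 0 < x → 0 < y →
        (∫ t in Set.Ioc (0:ℝ) x, f t) = (∫ t in Set.Ioc (0:ℝ) y, g t) →
        (1/mf) * (∫ t in Set.Ioc (0:ℝ) x, t * f t) ≥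
          (1/mg) * (∫ t in Set.Ioc (0:ℝ) y, t * g t) )
    ↔
    ( ∀ ψ : ℝ → ℝ, ContinuousOn ψ (Set.Ici 0) → ConvexOn ℝ (Set.Ici 0) ψ →
        MeasureTheory.IntegrableOn (fun t => ψ (t/mf) * f t) (Set.Ioi 0) →
        MeasureTheory.IntegrableOn (fun t => ψ (t/mg) * g t) (Set.Ioi 0) →
        (∫ t in Set.Ioi (0:ℝ), ψ (t/mf) * f t) ≤
          (∫ t in Set.Ioi (0:ℝ), ψ (t/mg) * g t) ) := by
  have hf : IsDensityWithMean f mf :=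
    ⟨hf_nonneg, hf_int, hf_prob, hf_mean_int, hmf.symm, hmf_pos⟩
  have hg : IsDensityWithMean g mg :=
    ⟨hg_nonneg, hg_int, hg_prob, hg_mean_int, hmg.symm, hmg_pos⟩
  refine ⟨fun hL ψ hψ hconv hψf hψg => hf.integral_convex_le hg hF_mono hL hψ hconv hψf hψg,
    fun h x y hx hy hxy => ?_⟩
  have hconv : ConvexOn ℝ (Ici 0) fun u : ℝ => max (1 * u + -(y / mg)) 0 := by
    refine ConvexOn.sup ?_ (convexOn_const 0 (convex_Ici 0))
    simp only [one_mul]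
    exact (convexOn_id (convex_Ici (0 : ℝ))).add_const (-(y / mg))
  have hle := h _ (by fun_prop) hconv (hf.integrable_max_affine_mul 1 (-(y / mg)))
    (hg.integrable_max_affine_mul 1 (-(y / mg)))
  rw [hg.integral_hinge hy.le] at hle
  have hlower := hf.le_integral_hinge (y / mg) hx.le
  rw [hxy] at hlower
  linarith
end
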